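/- Let B and D be two subsets of [n]. For each m ∈ ℕ, set δ̃_{D,B,m} := ∑_{C ⊆ B, |C| = |D|} δ_{D,C,m} ∈ ℤ. Then (∏_{m=0}^{|D|} (∇̃_{B,D} − δ̃_{D,B,m})) · ∇̃_{B,D} = 0 in k[S_n]. In particular, the minimal polynomial of ∇̃_{B,D} divides a product of linear factors with integer coefficients. -/

import Mathlib

open Finset

/-- The rectangular rook sum `∇̃_{B,A} = ∑_{w ∈ S_n, w(A) ⊆ B} w` in the group
algebra `k[S_n]`. -/
noncomputable def rookSumTilde (k : Type*) [CommRing k] {n : ℕ} (B A : Finset (Fin n)) :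
    MonoidAlgebra k (Equiv.Perm (Fin n)) :=
  ∑ w ∈ Finset.univ.filter (fun w : Equiv.Perm (Fin n) => A.image ⇑w ⊆ B),
    MonoidAlgebra.of k (Equiv.Perm (Fin n)) w

/-- The integer `ω_{B,C} = |B∩C|! ⬝ |B∖C|! ⬝ |C∖B|! ⬝ |[n]∖(B∪C)|!`. -/
def omegaBC {n : ℕ} (B C : Finset (Fin n)) : ℕ :=
  (B ∩ C).card.factorial * (B \ C).card.factorial * (C \ B).card.factorial *
    ((B ∪ C)ᶜ).card.factorial

/-- The integer `δ_{D,C,m} = ∑_{B ⊆ D, |B| = m} ω_{B,C} (−1)^{m − |B∩C|} binom(m, |B∩C|)`. -/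
def deltaDCm {n : ℕ} (D C : Finset (Fin n)) (m : ℕ) : ℤ :=
  ∑ B ∈ D.powerset.filter (fun B => B.card = m),
    (omegaBC B C : ℤ) * (-1 : ℤ) ^ (m - (B ∩ C).card) * (m.choose ((B ∩ C).card) : ℤ)

/-- The integer `δ̃_{D,B,m} = ∑_{C ⊆ B, |C| = |D|} δ_{D,C,m}`. -/
def deltaTilde {n : ℕ} (D B : Finset (Fin n)) (m : ℕ) : ℤ :=
  ∑ C ∈ B.powerset.filter (fun C => C.card = D.card), deltaDCm D C m

/-- The number of permutations carrying `f` to `g` is a product of factorials if `f` and `g` have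
equinumerous fibers. -/
theorem card_perm_comp_eq {α ι : Type*} [Fintype α] [DecidableEq α] [Fintype ι] [DecidableEq ι]
    (f g : α → ι) (h : ∀ i, #{a | f a = i} = #{a | g a = i}) :
    #{v : Equiv.Perm α | g ∘ v = f} = ∏ i, (#{a | g a = i}).factorial := by
  have e : ∀ i, Nonempty ({a // f a = i} ≃ {a // g a = i}) := fun i =>
    ⟨Fintype.equivOfCardEq (by simpa [Fintype.card_subtype] using h i)⟩
  let σ : Equiv.Perm α := Equiv.ofFiberEquiv fun i => (e i).some
  have hσ : g ∘ σ = f := funext fun a => Equiv.ofFiberEquiv_map _ a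
  have hstab := DomMulAct.stabilizer_card g
  simp only [Fintype.card_subtype] at hstab
  rw [← hstab]
  refine Finset.card_equiv (Equiv.mulRight σ⁻¹) fun v => ?_
  simp only [mem_filter, mem_univ, true_and, Equiv.coe_mulRight, Equiv.Perm.coe_mul, ← hσ]
  constructor
  · intro hv
    rw [← Function.comp_assoc, hv, Function.comp_assoc, ← Equiv.Perm.coe_mul]
    simp
  · intro hv
    rw [← Function.comp_assoc] at hv
    conv_rhs => rw [← hv]
    rw [Function.comp_assoc, ← Equiv.Perm.coe_mul]
    simp

/-- The permutations carrying a pair of sets `(D, W)` to a pair `(C, U)` exist only if the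
intersections have equal size, and are then counted by `omegaBC U C`. -/
theorem card_perm_image_eq_and_image_eq {n : ℕ} {C D U W : Finset (Fin n)}
    (hCD : #C = #D) (hUW : #U = #W) :
    #{v : Equiv.Perm (Fin n) | D.image v = C ∧ W.image v = U} =
      if #(W ∩ D) = #(U ∩ C) then omegaBC U C else 0 := by
  split_ifs with h
  · have hfib (X Y : Finset (Fin n)) (i : Bool × Bool) :
        #{a | (decide (a ∈ X), decide (a ∈ Y)) = i} =
          if i.1 then (if i.2 then #(X ∩ Y) else #(X \ Y))
          else (if i.2 then #(Y \ X) else #((X ∪ Y)ᶜ)) := by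
      rcases i with ⟨_ | _, _ | _⟩ <;> (simp; congr 1; ext a; simp; try tauto)
    have h1 := card_perm_comp_eq
      (fun a => (decide (a ∈ W), decide (a ∈ D))) (fun a => (decide (a ∈ U), decide (a ∈ C)))
      (fun i => by
        rw [hfib, hfib]
        have := card_inter_add_card_sdiff W D
        have := card_inter_add_card_sdiff U C
        have := card_inter_add_card_sdiff D W
        have := card_inter_add_card_sdiff C U
        have := card_union_add_card_inter W D
        have := card_union_add_card_inter U C
        rw [inter_comm D W] at *
        rw [inter_comm C U] at *
        rw [card_compl, card_compl]
        rcases i with ⟨_ | _, _ | _⟩ <;> simp <;> omega)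
    simp only [hfib, Fintype.prod_prod_type, Fintype.prod_bool] at h1
    simp only [if_true, Bool.false_eq_true, if_false] at h1
    rw [omegaBC, mul_assoc, ← h1]
    congr 1
    ext v
    simp only [mem_filter, mem_univ, true_and, funext_iff, Function.comp_apply, Prod.mk.injEq,
      decide_eq_decide]
    have himg (X Y : Finset (Fin n)) : X.image v = Y ↔ ∀ a, v a ∈ Y ↔ a ∈ X := by
      rw [Finset.ext_iff, ← v.forall_congr_right]
      simp [eq_comm, iff_comm]
    rw [himg, himg, forall_and, and_comm]
  · rw [card_eq_zero, filter_eq_empty_iff]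
    rintro v - ⟨rfl, rfl⟩
    apply h
    rw [← image_inter _ _ v.injective, card_image_of_injective _ v.injective]

/-- Inversion formula expressing the indicator of `#(V ∩ E) = r` through subset indicators. -/
theorem sum_powerset_neg_one_pow_mul_choose {α : Type*} [DecidableEq α] (V E : Finset α) (r : ℕ) :
    (∑ P ∈ V.powerset, if P ⊆ E then (-1 : ℤ) ^ (#P - r) * ((#P).choose r : ℤ) else 0) =
      if #(V ∩ E) = r then 1 else 0 := by
  have h1 : V.powerset.filter (· ⊆ E) = (V ∩ E).powerset := by
    ext P; rw [mem_filter, mem_powerset, mem_powerset, subset_inter_iff]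
  rw [← sum_filter, h1,
    sum_powerset_apply_card (fun j => (-1 : ℤ) ^ (j - r) * (j.choose r : ℤ))]
  generalize #(V ∩ E) = s
  rcases lt_or_ge s r with hs | hs
  · rw [if_neg hs.ne]
    refine sum_eq_zero fun j hj => ?_
    rw [Nat.choose_eq_zero_of_lt (show j < r by rw [mem_range] at hj; omega)]
    simp
  · obtain ⟨t, rfl⟩ := Nat.exists_eq_add_of_le hs
    rw [show r + t + 1 = r + (t + 1) by ring, sum_range_add, sum_eq_zero, zero_add]
    · have h2 : ∀ i ∈ range (t + 1), (r + t).choose (r + i) •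
          ((-1 : ℤ) ^ (r + i - r) * ((r + i).choose r : ℤ)) =
          ((r + t).choose r : ℤ) * ((-1) ^ i * (t.choose i : ℤ)) := fun i _ => by
        have := Nat.choose_mul (n := r + t) (k := r + i) (s := r) (by omega)
        simp only [Nat.add_sub_cancel_left] at this ⊢
        have h3 : ((r + t).choose (r + i) : ℤ) * ((r + i).choose r : ℤ) =
          ((r + t).choose r : ℤ) * (t.choose i : ℤ) := by exact_mod_cast this
        rw [nsmul_eq_mul]
        linear_combination (-1) ^ i * h3
      rw [sum_congr rfl h2, ← mul_sum, Int.alternating_sum_range_choose]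
      rcases t with _ | t <;> simp
    · intro j hj
      rw [Nat.choose_eq_zero_of_lt (mem_range.mp hj)]
      simp

/-- The sum of all permutations `w` with `V ⊆ w(D)` in the group algebra. -/
noncomputable def containingSum (k : Type*) [CommRing k] {n : ℕ} (D V : Finset (Fin n)) :
    MonoidAlgebra k (Equiv.Perm (Fin n)) :=
  ∑ w ∈ univ.filter (fun w : Equiv.Perm (Fin n) => V ⊆ D.image w),
    MonoidAlgebra.of k (Equiv.Perm (Fin n)) w

/-- The coefficient of `containingSum k D P` in `containingSum k D V * rookSumTilde k B D`, for
`#V = m` and `#P = j`. -/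
def containingCoeff {n : ℕ} (D B : Finset (Fin n)) (m j : ℕ) : ℤ :=
  ∑ C ∈ B.powerset with #C = #D, ∑ U ∈ D.powerset with #U = m,
    (omegaBC U C : ℤ) * (-1 : ℤ) ^ (j - #(U ∩ C)) * (j.choose #(U ∩ C) : ℤ)

theorem containingCoeff_self {n : ℕ} (D B : Finset (Fin n)) (m : ℕ) :
    containingCoeff D B m m = deltaTilde D B m :=
  rfl

theorem rookSumTilde_eq_sum_containingSum (k : Type*) [CommRing k] {n : ℕ}
    (B D : Finset (Fin n)) :
    rookSumTilde k B D = ∑ C ∈ B.powerset with #C = #D, containingSum k D C := by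
  have h (C : Finset (Fin n)) (hC : #C = #D) (w : Equiv.Perm (Fin n)) :
      C ⊆ D.image w ↔ C = D.image w := by
    refine ⟨fun h => eq_of_subset_of_card_le h ?_, fun h => h.subset⟩
    rw [card_image_of_injective _ w.injective, hC]
  have hC (C : Finset (Fin n)) : containingSum k D C =
      ∑ w : Equiv.Perm (Fin n), if C ⊆ D.image w then MonoidAlgebra.of k _ w else 0 :=
    sum_filter _ _
  rw [rookSumTilde, sum_filter, sum_congr rfl fun C _ => hC C, sum_comm]
  refine sum_congr rfl fun w _ => ?_
  have hw : #(D.image w) = #D := card_image_of_injective _ w.injective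
  rw [sum_congr rfl (g := fun C => if C = D.image w then MonoidAlgebra.of k _ w else 0)]
  · simp [sum_ite_eq', hw]
  · intro C hC
    simp only [mem_filter] at hC
    simp only [h C hC.2 w]

/-- For fixed `w`, the number of `v` contributing to the coefficient of `w` in
`containingSum k D V * rookSumTilde k B D`. -/
theorem card_subset_image_mul_inv {n : ℕ} (B D V : Finset (Fin n)) (w : Equiv.Perm (Fin n)) :
    (#{v : Equiv.Perm (Fin n) | D.image v ⊆ B ∧ V ⊆ D.image (w * v⁻¹)} : ℤ) =
      ∑ P ∈ V.powerset, if P ⊆ D.image w then containingCoeff D B #V #P else 0 := by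
  set W := V.image ⇑w⁻¹ with hW
  have hWV : #W = #V := card_image_of_injective _ w⁻¹.injective
  have hcard : #(W ∩ D) = #(V ∩ D.image w) := by
    rw [← card_image_of_injective (W ∩ D) w.injective, image_inter _ _ w.injective, hW,
      image_image]
    simp
  have hsub (v : Equiv.Perm (Fin n)) : V ⊆ D.image (w * v⁻¹) ↔ W.image v ⊆ D := by
    simp only [hW, image_image, subset_iff, mem_image, Function.comp_apply, Equiv.Perm.mul_apply]
    constructor
    · rintro h _ ⟨a, ha, rfl⟩
      obtain ⟨d, hd, rfl⟩ := h ha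
      simpa using hd
    · intro h a ha
      exact ⟨v (w⁻¹ a), h ⟨a, ha, rfl⟩, by simp⟩
  have hleft : #{v : Equiv.Perm (Fin n) | D.image v ⊆ B ∧ V ⊆ D.image (w * v⁻¹)} =
      ∑ C ∈ B.powerset with #C = #D, ∑ U ∈ D.powerset with #U = #V,
        #{v : Equiv.Perm (Fin n) | D.image v = C ∧ W.image v = U} := by
    rw [← sum_product', card_eq_sum_card_fiberwise
      (f := fun v : Equiv.Perm (Fin n) => (D.image v, W.image v))
      (t := (B.powerset.filter (#· = #D)) ×ˢ (D.powerset.filter (#· = #V)))]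
    · refine sum_congr rfl fun p hp => ?_
      simp only [mem_product, mem_filter, mem_powerset] at hp
      congr 1
      ext v
      simp only [mem_filter, mem_univ, true_and, hsub, Prod.ext_iff]
      constructor
      · exact fun h => h.2
      · rintro ⟨h1, h2⟩
        exact ⟨⟨h1 ▸ hp.1.1, h2 ▸ hp.2.1⟩, h1, h2⟩
    · intro v hv
      simp only [coe_filter, mem_univ, true_and, Set.mem_ofPred_eq, hsub] at hv
      simp [hv.1, hv.2, card_image_of_injective _ v.injective, hWV]
  rw [hleft]
  rw [← sum_filter]
  simp only [containingCoeff]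
  push_cast
  symm
  rw [sum_comm]
  refine sum_congr rfl fun C hC => ?_
  rw [sum_comm]
  refine sum_congr rfl fun U hU => ?_
  simp only [mem_filter] at hC hU
  rw [card_perm_image_eq_and_image_eq hC.2 (hU.2.trans hWV.symm), hcard]
  simp only [mul_assoc, ← mul_sum]
  rw [sum_filter, sum_powerset_neg_one_pow_mul_choose]
  split_ifs <;> simp

theorem containingSum_mul_rookSumTilde (k : Type*) [CommRing k] {n : ℕ}
    (B D V : Finset (Fin n)) :
    containingSum k D V * rookSumTilde k B D =
      ∑ P ∈ V.powerset, ((containingCoeff D B #V #P : ℤ) : k) • containingSum k D P := by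
  have hleft : containingSum k D V * rookSumTilde k B D =
      ∑ w : Equiv.Perm (Fin n),
        ((#{v : Equiv.Perm (Fin n) | D.image v ⊆ B ∧ V ⊆ D.image (w * v⁻¹)} : ℤ) : k) •
          MonoidAlgebra.of k (Equiv.Perm (Fin n)) w := by
    rw [containingSum, rookSumTilde, sum_mul_sum, sum_comm]
    have hv (v : Equiv.Perm (Fin n)) :
        ∑ u ∈ univ.filter (fun u : Equiv.Perm (Fin n) => V ⊆ D.image u),
          MonoidAlgebra.of k _ u * MonoidAlgebra.of k _ v =
        ∑ w : Equiv.Perm (Fin n), if V ⊆ D.image (w * v⁻¹) then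
          MonoidAlgebra.of k (Equiv.Perm (Fin n)) w else 0 := by
      rw [sum_filter]
      refine Fintype.sum_equiv (Equiv.mulRight v) _ _ fun u => ?_
      simp only [Equiv.coe_mulRight, mul_inv_cancel_right, map_mul]
    simp only [hv]
    rw [sum_comm]
    refine sum_congr rfl fun w _ => ?_
    rw [← sum_filter, filter_filter, sum_const, Int.cast_natCast, Nat.cast_smul_eq_nsmul]
  rw [hleft]
  simp only [card_subset_image_mul_inv, Int.cast_sum, sum_smul, containingSum, smul_sum]
  rw [sum_comm]
  refine sum_congr rfl fun P _ => ?_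
  rw [sum_filter]
  refine sum_congr rfl fun w _ => ?_
  split_ifs <;> simp

theorem containingSum_mul_prod_eq_zero (k : Type*) [CommRing k] {n : ℕ}
    (B D : Finset (Fin n)) (N : ℕ) (V : Finset (Fin n)) (hV : #V < N) :
    containingSum k D V * ((List.range N).map (fun m => rookSumTilde k B D -
      ((deltaTilde D B m : ℤ) : k) • (1 : MonoidAlgebra k (Equiv.Perm (Fin n))))).prod = 0 := by
  induction N generalizing V with
  | zero => omega
  | succ N ih =>
    rw [List.range_succ, List.map_append, List.prod_append, List.map_singleton,
      List.prod_singleton]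
    rcases Nat.lt_succ_iff_lt_or_eq.mp hV with h | h
    · rw [← mul_assoc, ih V h, zero_mul]
    · have hcomm : Commute (rookSumTilde k B D -
          ((deltaTilde D B N : ℤ) : k) • (1 : MonoidAlgebra k (Equiv.Perm (Fin n))))
          (((List.range N).map (fun m => rookSumTilde k B D -
            ((deltaTilde D B m : ℤ) : k) • (1 : MonoidAlgebra k (Equiv.Perm (Fin n))))).prod) := by
        refine Commute.list_prod_right _ _ fun x hx => ?_
        obtain ⟨m, -, rfl⟩ := List.mem_map.mp hx
        exact ((Commute.refl _).sub_right ((Commute.one_right _).smul_right _)).sub_left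
          (((Commute.one_left _).smul_left _))
      rw [← hcomm.eq, ← mul_assoc, mul_sub, containingSum_mul_rookSumTilde, mul_smul_comm, mul_one,
        ← add_sum_erase _ _ (mem_powerset_self V), containingCoeff_self, h, add_sub_cancel_left,
        sum_mul]
      refine sum_eq_zero fun P hP => ?_
      rw [mem_erase, mem_powerset] at hP
      rw [smul_mul_assoc, ih P (h ▸ card_lt_card (hP.2.ssubset_of_ne hP.1)), smul_zero]

/-- Theorem (triangularity for `∇̃`):
`(∏_{m=0}^{|D|} (∇̃_{B,D} − δ̃_{D,B,m})) ∇̃_{B,D} = 0` in `k[S_n]`, where the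
integer `δ̃_{D,B,m}` is identified with the corresponding scalar multiple of the
identity of `k[S_n]` (via the canonical ring map `ℤ → k`). -/
theorem rookSumTilde_triangular {n : ℕ} (k : Type*) [CommRing k] (B D : Finset (Fin n)) :
    (((List.range (D.card + 1)).map (fun m =>
        rookSumTilde k B D -
          ((deltaTilde D B m : ℤ) : k) • (1 : MonoidAlgebra k (Equiv.Perm (Fin n))))).prod) *
      rookSumTilde k B D = 0 := by
  have hcomm : Commute (((List.range (D.card + 1)).map (fun m =>
      rookSumTilde k B D -
        ((deltaTilde D B m : ℤ) : k) • (1 : MonoidAlgebra k (Equiv.Perm (Fin n))))).prod)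
      (rookSumTilde k B D) := by
    refine Commute.list_prod_left _ _ fun x hx => ?_
    obtain ⟨m, -, rfl⟩ := List.mem_map.mp hx
    exact (Commute.refl _).sub_left ((Commute.one_left _).smul_left _)
  rw [hcomm.eq]
  nth_rewrite 1 [rookSumTilde_eq_sum_containingSum]
  rw [sum_mul]
  refine sum_eq_zero fun C hC => containingSum_mul_prod_eq_zero k B D _ C ?_
  rw [(mem_filter.mp hC).2]
  exact Nat.lt_succ_self _
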